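/- arXiv:1311.0128 — 2 statements merged into one kernel-verified Lean document; each statement's English description precedes it below -/
import Mathlib

section
/- Let λ, c > 0 and t > 0. Then the integral over the closed ball of radius ct in ℝ³ of the absolutely continuous density of Y₃(t) equals the probability of at least one change of direction: ∫_{‖y‖ ≤ ct} (λ/(2c)) · (1/(π(e^{λt} − 1))) · Σ_{k=0}^∞ (λ/(2c))^{k+1} (c²t² − ‖y‖²)^{(k−1)/2} / ( Γ((k+1)/2) Γ((k+3)/2) ) dy = 1 − λt/(e^{λt} − 1). -/
open Real

lemma beta_scaled_real {s t a : ℝ} (hs : 0 < s) (ht : 0 < t) (ha : 0 < a) :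
    ∫ x in Set.Ioc 0 a, x ^ (s - 1) * (a - x) ^ (t - 1) =
      a ^ (s + t - 1) * (Real.Gamma s * Real.Gamma t / Real.Gamma (s + t)) := by
  have h := Complex.betaIntegral_scaled (s : ℂ) (t : ℂ) ha
  rw [Complex.betaIntegral_eq_Gamma_mul_div _ _ (by simpa) (by simpa),
    intervalIntegral.integral_of_le ha.le] at h
  have h2 : ∫ x in Set.Ioc 0 a, (x : ℂ) ^ ((s : ℂ) - 1) * ((a : ℂ) - x) ^ ((t : ℂ) - 1)
      = ∫ x in Set.Ioc 0 a, ((x ^ (s - 1) * (a - x) ^ (t - 1) : ℝ) : ℂ) := by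
    refine MeasureTheory.setIntegral_congr_fun measurableSet_Ioc fun x hx => ?_
    have h1 : 0 ≤ a - x := by linarith [hx.2]
    push_cast [Complex.ofReal_cpow hx.1.le, Complex.ofReal_cpow h1]
    rfl
  rw [h2, integral_complex_ofReal] at h
  apply Complex.ofReal_injective
  rw [h]
  push_cast [Complex.ofReal_cpow ha.le, ← Complex.Gamma_ofReal]
  rfl

lemma radial_int {R : ℝ} (hR : 0 < R) (k : ℕ) :
    ∫ r in Set.Ioi (0 : ℝ), r ^ 2 *
      (Set.Iic R).indicator (fun r => (R ^ 2 - r ^ 2) ^ (((k : ℝ) - 1) / 2)) r =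
      1 / 2 * (R ^ (k + 2) * (Real.Gamma (3 / 2) * Real.Gamma (((k : ℝ) + 1) / 2) /
        Real.Gamma (((k : ℝ) + 4) / 2))) := by
  have h := beta_scaled_real (s := 3 / 2) (t := ((k : ℝ) + 1) / 2) (a := R ^ 2) (by norm_num)
    (by positivity) (by positivity)
  have e1 : (3 : ℝ) / 2 + ((k : ℝ) + 1) / 2 = ((k : ℝ) + 4) / 2 := by ring
  have e2 : (R ^ 2) ^ (((k : ℝ) + 4) / 2 - 1) = R ^ (k + 2) := by
    rw [← Real.rpow_natCast R 2, ← Real.rpow_mul hR.le, ← Real.rpow_natCast]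
    congr 1
    push_cast
    ring
  rw [e1, e2] at h
  rw [← h]
  have hset : Set.Ioc 0 (R ^ 2) = Set.Iic (R ^ 2) ∩ Set.Ioi 0 := by
    ext x; simp [and_comm]
  rw [hset, ← MeasureTheory.Measure.restrict_restrict measurableSet_Iic,
    ← MeasureTheory.integral_indicator measurableSet_Iic]
  conv_rhs => rw [← MeasureTheory.integral_comp_rpow_Ioi_of_pos (p := 2) two_pos,
    ← MeasureTheory.integral_const_mul]
  refine MeasureTheory.setIntegral_congr_fun measurableSet_Ioi fun x hx => ?_
  have hx : 0 < x := hx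
  have e3 : x ^ (2 : ℝ) = x ^ 2 := by norm_num
  have e4 : ((k : ℝ) + 1) / 2 - 1 = ((k : ℝ) - 1) / 2 := by ring
  have e5 : (x ^ 2) ^ ((3 : ℝ) / 2 - 1) = x := by
    rw [← Real.rpow_natCast x 2, ← Real.rpow_mul hx.le]
    norm_num
  simp only [e3, smul_eq_mul]
  by_cases hxR : x ≤ R
  · have h' : x ^ 2 ≤ R ^ 2 := by gcongr
    rw [Set.indicator_of_mem (by exact hxR), Set.indicator_of_mem (by exact h'), e4, e5]
    norm_num
    ring
  · have h' : ¬ x ^ 2 ≤ R ^ 2 := by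
      push Not at hxR ⊢
      gcongr
    rw [Set.indicator_of_notMem (by exact hxR), Set.indicator_of_notMem (by exact h')]
    simp


lemma gamma_prod (k : ℕ) : Real.Gamma (((k : ℝ) + 3) / 2) * Real.Gamma (((k : ℝ) + 4) / 2) =
    ((k + 2).factorial : ℝ) * √π / 2 ^ (k + 2) := by
  have h := Real.Gamma_mul_Gamma_add_half (((k : ℝ) + 3) / 2)
  have e1 : ((k : ℝ) + 3) / 2 + 1 / 2 = ((k : ℝ) + 4) / 2 := by ring
  have e2 : 2 * (((k : ℝ) + 3) / 2) = ((k + 2 : ℕ) : ℝ) + 1 := by push_cast; ring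
  rw [e1, e2, Real.Gamma_nat_eq_factorial] at h
  rw [h]
  have e3 : (1 : ℝ) - (((k + 2 : ℕ) : ℝ) + 1) = -((k + 2 : ℕ) : ℝ) := by ring
  rw [e3, Real.rpow_neg two_pos.le, Real.rpow_natCast]
  ring

lemma gamma_three_half : Real.Gamma (3 / 2) = √π / 2 := by
  have : (3 : ℝ) / 2 = 1 / 2 + 1 := by norm_num
  rw [this, Real.Gamma_add_one (by norm_num), Real.Gamma_one_half_eq]
  ring

lemma radial_sum {R a : ℝ} (hR : 0 < R) (ha : 0 < a) :
    ∫ r in Set.Ioi (0 : ℝ), r ^ 2 *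
      (Set.Iic R).indicator (fun r => ∑' k : ℕ, a ^ (k + 1) * (R ^ 2 - r ^ 2) ^ (((k : ℝ) - 1) / 2) /
            (Real.Gamma (((k : ℝ) + 1) / 2) * Real.Gamma (((k : ℝ) + 3) / 2))) r =
      (Real.exp (2 * a * R) - 1 - 2 * a * R) / (4 * a) := by
  let F : ℕ → ℝ → ℝ := fun k r => a ^ (k + 1) /
    (Real.Gamma (((k : ℝ) + 1) / 2) * Real.Gamma (((k : ℝ) + 3) / 2)) * (r ^ 2 *
      (Set.Iic R).indicator (fun r => (R ^ 2 - r ^ 2) ^ (((k : ℝ) - 1) / 2)) r)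
  have hg : ∀ x : ℝ, 0 < x → ∀ k : ℕ, 0 < Real.Gamma (((k : ℝ) + x) / 2) := fun x hx k =>
    Real.Gamma_pos_of_pos (by positivity)
  have hF : ∀ k, ∫ r in Set.Ioi (0 : ℝ), F k r =
      (1 / (4 * a)) * ((2 * a * R) ^ (k + 2) / ((k + 2).factorial : ℝ)) := by
    intro k
    simp only [F]
    rw [MeasureTheory.integral_const_mul, radial_int hR, gamma_three_half]
    have h1 := hg 1 one_pos k
    have h3 := hg 3 (by norm_num) k
    have h4 := hg 4 (by norm_num) k
    have hp := gamma_prod k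
    have hpi : 0 < √π := by positivity
    have hf : (0 : ℝ) < (k + 2).factorial := by positivity
    have : a ^ (k + 1) / (Gamma (((k : ℝ) + 1) / 2) * Gamma (((k : ℝ) + 3) / 2)) *
      (1 / 2 * (R ^ (k + 2) * (√π / 2 * Gamma (((k : ℝ) + 1) / 2) / Gamma (((k : ℝ) + 4) / 2))))
      = a ^ (k + 1) * R ^ (k + 2) * √π / 4 /
        (Gamma (((k : ℝ) + 3) / 2) * Gamma (((k : ℝ) + 4) / 2)) := by
      field_simp
      norm_num
    rw [this, hp]
    field_simp
    ring
  have hFint : ∀ k, MeasureTheory.Integrable (F k)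
      (MeasureTheory.volume.restrict (Set.Ioi (0 : ℝ))) := fun k =>
    MeasureTheory.Integrable.of_integral_ne_zero (by rw [hF k]; positivity)
  have hFn : ∀ k r, 0 < r → 0 ≤ F k r := by
    intro k r hr0
    have h1 := hg 1 one_pos k
    have h3 := hg 3 (by norm_num) k
    simp only [F]
    refine mul_nonneg (by positivity) (mul_nonneg (by positivity) ?_)
    by_cases hr : r ∈ Set.Iic R
    · rw [Set.indicator_of_mem hr]
      have hr' : r ≤ R := hr
      have : 0 ≤ R ^ 2 - r ^ 2 := sub_nonneg.2 (by gcongr)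
      positivity
    · rw [Set.indicator_of_notMem hr]
  have hs : HasSum (fun k : ℕ => (1 / (4 * a)) * ((2 * a * R) ^ (k + 2) / ((k + 2).factorial : ℝ)))
      ((1 / (4 * a)) * (Real.exp (2 * a * R) - 1 - 2 * a * R)) := by
    refine HasSum.mul_left _ ?_
    have h := NormedSpace.expSeries_div_hasSum_exp (𝔸 := ℝ) (2 * a * R)
    rw [← Real.exp_eq_exp_ℝ] at h
    have h2 := (hasSum_nat_add_iff' 2).2 h
    simpa [Finset.sum_range_succ, sub_sub] using h2
  have hN : ∀ k, ∫ r in Set.Ioi (0 : ℝ), ‖F k r‖ =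
      (1 / (4 * a)) * ((2 * a * R) ^ (k + 2) / ((k + 2).factorial : ℝ)) := by
    intro k
    rw [← hF k]
    refine MeasureTheory.setIntegral_congr_fun measurableSet_Ioi fun x hx => ?_
    exact Real.norm_of_nonneg (hFn k x hx)
  have key := MeasureTheory.hasSum_integral_of_summable_integral_norm hFint
    (by simp_rw [hN]; exact hs.summable)
  simp_rw [hF] at key
  have e := key.unique hs
  rw [div_eq_inv_mul, ← one_div, ← e]
  congr 1 with r
  by_cases hr : r ∈ Set.Iic R
  · simp only [F, Set.indicator_of_mem hr]
    rw [← tsum_mul_left]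
    congr 1 with k
    ring
  · simp only [F, Set.indicator_of_notMem hr]
    simp

/-- the total mass of the absolutely continuous component of the
distribution of the random flight `Y₃(t)`:
`∫_{‖y‖ ≤ ct} (λ/(2c)) (1/(π(e^{λt}-1))) Σ_{k=0}^∞ (λ/(2c))^{k+1}
    (c²t² - ‖y‖²)^{(k-1)/2}/(Γ((k+1)/2) Γ((k+3)/2)) dy = 1 - λt/(e^{λt} - 1)`. -/
theorem statement12 (lam c t : ℝ) (hlam : 0 < lam) (hc : 0 < c) (ht : 0 < t) :
    (∫ y in Metric.closedBall (0 : EuclideanSpace ℝ (Fin 3)) (c * t),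
      lam / (2 * c) * (1 / (π * (Real.exp (lam * t) - 1))) *
        ∑' k : ℕ,
          (lam / (2 * c)) ^ (k + 1) *
            (c ^ 2 * t ^ 2 - ‖y‖ ^ 2) ^ (((k : ℝ) - 1) / 2) /
            (Real.Gamma (((k : ℝ) + 1) / 2) * Real.Gamma (((k : ℝ) + 3) / 2)))
    = 1 - lam * t / (Real.exp (lam * t) - 1) := by
  have hR : 0 < c * t := by positivity
  have ha : 0 < lam / (2 * c) := by positivity
  have hrad := radial_sum hR ha
  rw [MeasureTheory.integral_const_mul, ← MeasureTheory.integral_indicator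
    Metric.isClosed_closedBall.measurableSet]
  have hpol := MeasureTheory.integral_fun_norm_addHaar
    (MeasureTheory.volume : MeasureTheory.Measure (EuclideanSpace ℝ (Fin 3)))
    ((Set.Iic (c * t)).indicator (fun r => ∑' k : ℕ, (lam / (2 * c)) ^ (k + 1) *
      ((c * t) ^ 2 - r ^ 2) ^ (((k : ℝ) - 1) / 2) /
            (Real.Gamma (((k : ℝ) + 1) / 2) * Real.Gamma (((k : ℝ) + 3) / 2))))
  simp only [finrank_euclideanSpace, Fintype.card_fin, smul_eq_mul, Nat.add_one_sub_one] at hpol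
  rw [hrad] at hpol
  have hvol : (MeasureTheory.volume : MeasureTheory.Measure (EuclideanSpace ℝ (Fin 3))).real
      (Metric.ball 0 1) = π * 4 / 3 := by
    rw [MeasureTheory.measureReal_def, EuclideanSpace.volume_ball_fin_three]
    simp
    positivity
  rw [hvol] at hpol
  have hE : 0 < Real.exp (lam * t) - 1 := by
    have := Real.add_one_lt_exp (x := lam * t) (by positivity)
    have : 0 < lam * t := by positivity
    linarith
  have hlt : 2 * (lam / (2 * c)) * (c * t) = lam * t := by field_simp
  rw [hlt] at hpol
  refine (congrArg _ (Eq.trans ?_ hpol)).trans ?_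
  · congr 1 with y
    have hiff : y ∈ Metric.closedBall (0 : EuclideanSpace ℝ (Fin 3)) (c * t) ↔
        ‖y‖ ∈ Set.Iic (c * t) := by simp
    by_cases hy : ‖y‖ ∈ Set.Iic (c * t)
    · rw [Set.indicator_of_mem hy, Set.indicator_of_mem (hiff.2 hy), mul_pow]
    · rw [Set.indicator_of_notMem hy, Set.indicator_of_notMem (mt hiff.1 hy)]
  · have := pi_pos
    rw [nsmul_eq_mul]
    field_simp
    norm_num
end

section
/- Let λ, c > 0. Define u : ℝ² × (0,∞) → ℝ on the open cone {(x₁,x₂,t) : x₁² + x₂² < c²t², t > 0} by u(x₁,x₂,t) = (λ/(2πc)) · e^{−λt + (λ/c)√(c²t² − x₁² − x₂²)} / √(c²t² − x₁² − x₂²). Then u satisfies the planar telegraph equation (equation of damped waves) ∂²u/∂t² + 2λ ∂u/∂t = c² ( ∂²u/∂x₁² + ∂²u/∂x₂² ) on the open cone. -/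
open Real

lemma aux_first (K m d k a b s : ℝ) (h : 0 < a * s ^ 2 + b) :
    HasDerivAt (fun s => K * Real.exp (-(m * s) + d + k * √(a * s ^ 2 + b)) / √(a * s ^ 2 + b))
      (K * Real.exp (-(m * s) + d + k * √(a * s ^ 2 + b)) / √(a * s ^ 2 + b) *
        (-m + a * s * (k / √(a * s ^ 2 + b) - 1 / √(a * s ^ 2 + b) ^ 2))) s := by
  have hw : 0 < √(a * s ^ 2 + b) := Real.sqrt_pos.mpr h
  have h1 : HasDerivAt (fun s : ℝ => a * s ^ 2 + b) (a * (2 * s)) s := by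
    simpa using ((hasDerivAt_pow 2 s).const_mul a).add_const b
  have h2 := h1.sqrt h.ne'
  have h3 : HasDerivAt (fun s : ℝ => -(m * s) + d) (-m) s := by
    simpa using (((hasDerivAt_id s).const_mul m).neg).add_const d
  have h4 := (((h3.add (h2.const_mul k)).exp).const_mul K).div h2 hw.ne'
  refine h4.congr_deriv ?_
  simp only [Pi.add_apply]
  clear h4 h2
  generalize √(a * s ^ 2 + b) = w at hw ⊢
  field_simp
  ring

lemma aux_second (K m d k a b s : ℝ) (h : 0 < a * s ^ 2 + b) :
    iteratedDeriv 2
      (fun s => K * Real.exp (-(m * s) + d + k * √(a * s ^ 2 + b)) / √(a * s ^ 2 + b)) s =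
      K * Real.exp (-(m * s) + d + k * √(a * s ^ 2 + b)) / √(a * s ^ 2 + b) *
        ((-m + a * s * (k / √(a * s ^ 2 + b) - 1 / √(a * s ^ 2 + b) ^ 2)) ^ 2 +
          (a * (k / √(a * s ^ 2 + b) - 1 / √(a * s ^ 2 + b) ^ 2) +
            a * s * (-k / √(a * s ^ 2 + b) ^ 2 + 2 / √(a * s ^ 2 + b) ^ 3) *
              (a * s / √(a * s ^ 2 + b)))) := by
  have hw : 0 < √(a * s ^ 2 + b) := Real.sqrt_pos.mpr h
  rw [iteratedDeriv_succ, iteratedDeriv_one]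
  have hopen : ∀ᶠ r in nhds s, 0 < a * r ^ 2 + b := by
    have hcont : ContinuousAt (fun r : ℝ => a * r ^ 2 + b) s := by fun_prop
    exact hcont.eventually (lt_mem_nhds h)
  have heq := hopen.mono fun r hr => (aux_first K m d k a b r hr).deriv
  rw [Filter.EventuallyEq.deriv_eq heq]
  have h1 : HasDerivAt (fun s : ℝ => a * s ^ 2 + b) (a * (2 * s)) s := by
    simpa using ((hasDerivAt_pow 2 s).const_mul a).add_const b
  have h2 := h1.sqrt h.ne'
  have h3 : HasDerivAt (fun s : ℝ => a * s) a s := by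
    simpa using (hasDerivAt_id s).const_mul a
  have h5 := ((hasDerivAt_const s k).div h2 hw.ne').sub
    ((hasDerivAt_const s (1 : ℝ)).div (h2.pow 2) (pow_ne_zero 2 hw.ne'))
  have h6 := (aux_first K m d k a b s h).mul ((h3.mul h5).const_add (-m))
  refine Eq.trans h6.deriv ?_
  simp only [Pi.sub_apply, Pi.div_apply, Pi.mul_apply, Pi.pow_apply]
  clear h6 h5 h2
  generalize √(a * s ^ 2 + b) = w at hw ⊢
  field_simp
  push_cast
  ring



/-- the absolutely continuous component of the distribution of the
planar random motion with Poisson-paced changes of direction,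
`u(x₁,x₂,t) = (λ/(2πc)) e^{-λt + (λ/c)√(c²t²-x₁²-x₂²)}/√(c²t²-x₁²-x₂²)`,
satisfies the planar telegraph (damped wave) equation
`∂²u/∂t² + 2λ ∂u/∂t = c²(∂²u/∂x₁² + ∂²u/∂x₂²)` on the open cone
`{(x₁,x₂,t) : x₁² + x₂² < c²t², t > 0}`. -/
theorem statement17 (lam c : ℝ) (hlam : 0 < lam) (hc : 0 < c)
    (u : ℝ → ℝ → ℝ → ℝ)
    (hu : ∀ x₁ x₂ t : ℝ, u x₁ x₂ t =
      lam / (2 * π * c) *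
        Real.exp (-(lam * t) + lam / c * Real.sqrt (c ^ 2 * t ^ 2 - x₁ ^ 2 - x₂ ^ 2)) /
        Real.sqrt (c ^ 2 * t ^ 2 - x₁ ^ 2 - x₂ ^ 2)) :
    ∀ x₁ x₂ t : ℝ, 0 < t → x₁ ^ 2 + x₂ ^ 2 < c ^ 2 * t ^ 2 →
      iteratedDeriv 2 (fun s => u x₁ x₂ s) t
        + 2 * lam * deriv (fun s => u x₁ x₂ s) t
      = c ^ 2 * (iteratedDeriv 2 (fun s => u s x₂ t) x₁
          + iteratedDeriv 2 (fun s => u x₁ s t) x₂) := by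
  intro x y t ht hcone
  have hpos : 0 < c ^ 2 * t ^ 2 - x ^ 2 - y ^ 2 := by linarith
  have e1 : (fun s => u x y s) = fun s => lam / (2 * π * c) *
      Real.exp (-(lam * s) + 0 + lam / c * √(c ^ 2 * s ^ 2 + (-x ^ 2 - y ^ 2))) /
        √(c ^ 2 * s ^ 2 + (-x ^ 2 - y ^ 2)) := by
    funext s
    rw [hu, show c ^ 2 * s ^ 2 + (-x ^ 2 - y ^ 2) = c ^ 2 * s ^ 2 - x ^ 2 - y ^ 2 by ring,
      add_zero]
  have e2 : (fun s => u s y t) = fun s => lam / (2 * π * c) *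
      Real.exp (-(0 * s) + -(lam * t) + lam / c * √(-1 * s ^ 2 + (c ^ 2 * t ^ 2 - y ^ 2))) /
        √(-1 * s ^ 2 + (c ^ 2 * t ^ 2 - y ^ 2)) := by
    funext s
    rw [hu, show -1 * s ^ 2 + (c ^ 2 * t ^ 2 - y ^ 2) = c ^ 2 * t ^ 2 - s ^ 2 - y ^ 2 by ring,
      zero_mul, neg_zero, zero_add]
  have e3 : (fun s => u x s t) = fun s => lam / (2 * π * c) *
      Real.exp (-(0 * s) + -(lam * t) + lam / c * √(-1 * s ^ 2 + (c ^ 2 * t ^ 2 - x ^ 2))) /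
        √(-1 * s ^ 2 + (c ^ 2 * t ^ 2 - x ^ 2)) := by
    funext s
    rw [hu, show -1 * s ^ 2 + (c ^ 2 * t ^ 2 - x ^ 2) = c ^ 2 * t ^ 2 - x ^ 2 - s ^ 2 by ring,
      zero_mul, neg_zero, zero_add]
  rw [e1, e2, e3, aux_second _ _ _ _ _ _ _ (by linarith), aux_second _ _ _ _ _ _ _ (by linarith),
    aux_second _ _ _ _ _ _ _ (by linarith), (aux_first _ _ _ _ _ _ _ (by linarith)).deriv]
  rw [show c ^ 2 * t ^ 2 + (-x ^ 2 - y ^ 2) = c ^ 2 * t ^ 2 - x ^ 2 - y ^ 2 by ring,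
    show -1 * x ^ 2 + (c ^ 2 * t ^ 2 - y ^ 2) = c ^ 2 * t ^ 2 - x ^ 2 - y ^ 2 by ring,
    show -1 * y ^ 2 + (c ^ 2 * t ^ 2 - x ^ 2) = c ^ 2 * t ^ 2 - x ^ 2 - y ^ 2 by ring]
  simp only [zero_mul, neg_zero, zero_add, add_zero]
  have hw : 0 < √(c ^ 2 * t ^ 2 - x ^ 2 - y ^ 2) := Real.sqrt_pos.mpr hpos
  have hsq : √(c ^ 2 * t ^ 2 - x ^ 2 - y ^ 2) ^ 2 = c ^ 2 * t ^ 2 - x ^ 2 - y ^ 2 :=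
    Real.sq_sqrt hpos.le
  generalize √(c ^ 2 * t ^ 2 - x ^ 2 - y ^ 2) = w at hw hsq ⊢
  generalize lam / (2 * π * c) * Real.exp (-(lam * t) + lam / c * w) / w = F
  have hy : y ^ 2 = c ^ 2 * t ^ 2 - x ^ 2 - w ^ 2 := by linarith
  rw [← sub_eq_zero]
  field_simp
  ring_nf
  try simp only [hy]
  try ring_nf
end
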